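/- The product of the G_{G2}-orbits of (1,0) and (0,1), i.e. the 36-element multiset of sums p + q where p ranges over the 6-point orbit G_{G2}((1,0)) and q ranges over the 6-point orbit G_{G2}((0,1)), is equal to the multiset consisting of the twelve points of the orbit G_{G2}((1,1)) each with multiplicity one, the six points of the orbit G_{G2}((0,2)) each with multiplicity two, and the six points of the orbit G_{G2}((0,1)) each with multiplicity two. -/

import Mathlib

noncomputable section

/-- The first simple reflection in the ω-basis. -/
def f1 : (ℝ × ℝ) →ₗ[ℝ] (ℝ × ℝ) where
  toFun p := (-p.1, 3 * p.1 + p.2)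
  map_add' p q := by apply Prod.ext <;> simp <;> ring
  map_smul' c p := by apply Prod.ext <;> simp <;> ring

/-- The second simple reflection in the ω-basis. -/
def f2 : (ℝ × ℝ) →ₗ[ℝ] (ℝ × ℝ) where
  toFun p := (p.1 + p.2, -p.2)
  map_add' p q := by apply Prod.ext <;> simp <;> ring
  map_smul' c p := by apply Prod.ext <;> simp <;> ring

def r1 : (ℝ × ℝ) ≃ₗ[ℝ] (ℝ × ℝ) :=
  LinearEquiv.ofLinear f1 f1
    (by apply LinearMap.ext; intro p; apply Prod.ext <;> simp [f1] <;> ring)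
    (by apply LinearMap.ext; intro p; apply Prod.ext <;> simp [f1] <;> ring)

def r2 : (ℝ × ℝ) ≃ₗ[ℝ] (ℝ × ℝ) :=
  LinearEquiv.ofLinear f2 f2
    (by apply LinearMap.ext; intro p; apply Prod.ext <;> simp [f2] <;> ring)
    (by apply LinearMap.ext; intro p; apply Prod.ext <;> simp [f2] <;> ring)

/-- The Coxeter group, as the group of linear automorphisms of `ℝ²`
generated by the two simple reflections. -/
def GG2 : Subgroup ((ℝ × ℝ) ≃ₗ[ℝ] (ℝ × ℝ)) := Subgroup.closure {r1, r2}

/-- The orbit of `(1,0)` as a finite set. -/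
def O10 : Finset (ℝ × ℝ) := {(1, 0), (-1, 0), (-1, 3), (1, -3), (2, -3), (-2, 3)}

/-- The orbit of `(0,1)` as a finite set. -/
def O01 : Finset (ℝ × ℝ) := {(0, 1), (0, -1), (1, -1), (-1, 1), (-1, 2), (1, -2)}

/-- The orbit of `(0,2)` as a finite set. -/
def O02 : Finset (ℝ × ℝ) := {(0, 2), (0, -2), (2, -2), (-2, 2), (-2, 4), (2, -4)}

/-- The orbit of `(1,1)` as a finite set. -/
def O11 : Finset (ℝ × ℝ) :=
  {(1, 1), (-1, -1), (-1, 4), (1, -4), (3, -4), (-3, 4),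
   (-3, 5), (3, -5), (2, -5), (-2, 5), (-2, 1), (2, -1)}

theorem r1_apply (x y : ℝ) : r1 (x, y) = (-x, 3 * x + y) := rfl

theorem r2_apply (x y : ℝ) : r2 (x, y) = (x + y, -y) := rfl

theorem r1_r1 (p : ℝ × ℝ) : r1 (r1 p) = p := r1.apply_symm_apply p

theorem r2_r2 (p : ℝ × ℝ) : r2 (r2 p) = p := r2.apply_symm_apply p

theorem r1_mem_orbit {p q : ℝ × ℝ} (h : q ∈ MulAction.orbit GG2 p) :
    r1 q ∈ MulAction.orbit GG2 p :=
  MulAction.mem_orbit_of_mem_orbit (⟨r1, Subgroup.subset_closure (by simp)⟩ : GG2) h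

theorem r2_mem_orbit {p q : ℝ × ℝ} (h : q ∈ MulAction.orbit GG2 p) :
    r2 q ∈ MulAction.orbit GG2 p :=
  MulAction.mem_orbit_of_mem_orbit (⟨r2, Subgroup.subset_closure (by simp)⟩ : GG2) h

/-- A set stable under both simple reflections contains the orbit of each of its points. -/
theorem orbit_subset_of_stable {S : Set (ℝ × ℝ)} {p : ℝ × ℝ} (hp : p ∈ S)
    (h1 : ∀ q ∈ S, r1 q ∈ S) (h2 : ∀ q ∈ S, r2 q ∈ S) : MulAction.orbit GG2 p ⊆ S := by
  rintro _ ⟨⟨g, hg⟩, rfl⟩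
  have key : ∀ q, g q ∈ S ↔ q ∈ S := by
    induction hg using Subgroup.closure_induction with
    | mem g hg =>
      intro q
      rcases hg with rfl | rfl
      · exact ⟨fun h => r1_r1 q ▸ h1 _ h, h1 q⟩
      · exact ⟨fun h => r2_r2 q ▸ h2 _ h, h2 q⟩
    | one => exact fun q => Iff.rfl
    | mul a b _ _ ha hb => exact fun q => (ha (b q)).trans (hb q)
    | inv a _ ha =>
      intro q
      rw [← ha]
      exact iff_of_eq (congrArg (· ∈ S) (a.apply_symm_apply q))
  exact (key p).2 hp

/-- The orbit of `(a, 0)`. -/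
theorem orbit_fst (a : ℝ) : MulAction.orbit GG2 ((a, 0) : ℝ × ℝ) =
    {(a, 0), (-a, 0), (-a, 3 * a), (a, -(3 * a)), (2 * a, -(3 * a)), (-(2 * a), 3 * a)} := by
  apply Set.Subset.antisymm
  · apply orbit_subset_of_stable (by simp) <;>
    · simp only [Set.mem_insert_iff, Set.mem_singleton_iff]
      rintro q (rfl | rfl | rfl | rfl | rfl | rfl) <;>
        simp only [r1_apply, r2_apply] <;> ring_nf <;> simp
  · have e0 := MulAction.mem_orbit_self (M := GG2) ((a, 0) : ℝ × ℝ)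
    have e1 := r1_mem_orbit e0
    have e2 := r2_mem_orbit e1
    have e3 := r1_mem_orbit e2
    have e4 := r2_mem_orbit e3
    have e5 := r1_mem_orbit e4
    simp only [r1_apply, r2_apply] at e1 e2 e3 e4 e5
    rintro q (rfl | rfl | rfl | rfl | rfl | rfl)
    · exact e0
    · convert e5 using 2 <;> ring
    · convert e1 using 2; ring
    · convert e4 using 2 <;> ring
    · convert e2 using 2 <;> ring
    · convert e3 using 2 <;> ring

/-- The orbit of `(0, b)`. -/
theorem orbit_snd (b : ℝ) : MulAction.orbit GG2 ((0, b) : ℝ × ℝ) =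
    {(0, b), (0, -b), (b, -b), (-b, b), (-b, 2 * b), (b, -(2 * b))} := by
  apply Set.Subset.antisymm
  · apply orbit_subset_of_stable (by simp) <;>
    · simp only [Set.mem_insert_iff, Set.mem_singleton_iff]
      rintro q (rfl | rfl | rfl | rfl | rfl | rfl) <;>
        simp only [r1_apply, r2_apply] <;> ring_nf <;> simp
  · have e0 := MulAction.mem_orbit_self (M := GG2) ((0, b) : ℝ × ℝ)
    have e1 := r2_mem_orbit e0
    have e2 := r1_mem_orbit e1
    have e3 := r2_mem_orbit e2
    have e4 := r1_mem_orbit e3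
    have e5 := r2_mem_orbit e4
    simp only [r1_apply, r2_apply] at e1 e2 e3 e4 e5
    rintro q (rfl | rfl | rfl | rfl | rfl | rfl)
    · exact e0
    · convert e5 using 2 <;> ring
    · convert e1 using 2; ring
    · convert e4 using 2 <;> ring
    · convert e2 using 2 <;> ring
    · convert e3 using 2 <;> ring

theorem coe_O11 : (↑O11 : Set (ℝ × ℝ)) = MulAction.orbit GG2 ((1, 1) : ℝ × ℝ) := by
  apply Set.Subset.antisymm
  · have e := MulAction.mem_orbit_self (M := GG2) ((1, 1) : ℝ × ℝ)
    have a1 := r1_mem_orbit e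
    have a2 := r2_mem_orbit a1
    have a3 := r1_mem_orbit a2
    have a4 := r2_mem_orbit a3
    have a5 := r1_mem_orbit a4
    have b1 := r2_mem_orbit e
    have b2 := r1_mem_orbit b1
    have b3 := r2_mem_orbit b2
    have b4 := r1_mem_orbit b3
    have b5 := r2_mem_orbit b4
    have b6 := r1_mem_orbit b5
    norm_num [r1_apply, r2_apply] at a1 a2 a3 a4 a5 b1 b2 b3 b4 b5 b6
    intro q hq
    simp only [O11, Finset.coe_insert, Finset.coe_singleton] at hq
    rcases hq with rfl | rfl | rfl | rfl | rfl | rfl | rfl | rfl | rfl | rfl | rfl | rfl <;>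
      assumption
  · apply orbit_subset_of_stable (by simp [O11]) <;>
    · simp only [O11, Finset.mem_coe, Finset.mem_insert, Finset.mem_singleton]
      rintro q (rfl | rfl | rfl | rfl | rfl | rfl | rfl | rfl | rfl | rfl | rfl | rfl) <;>
        norm_num [r1_apply, r2_apply]

/-- The inclusion of the weight lattice `ℤ²` in `ℝ²`. -/
def latticeEmbedding : ℤ × ℤ ↪ ℝ × ℝ where
  toFun p := (p.1, p.2)
  inj' p q h := by simpa [Prod.ext_iff] using h

theorem latticeEmbedding_apply (p : ℤ × ℤ) :
    latticeEmbedding p = ((p.1 : ℝ), (p.2 : ℝ)) := rfl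

theorem latticeEmbedding_add (p q : ℤ × ℤ) :
    latticeEmbedding (p + q) = latticeEmbedding p + latticeEmbedding q := by
  simp [latticeEmbedding_apply]

theorem bind_O10_O01 : (O10.val.bind fun p => O01.val.map fun q => p + q) =
    O11.val + (O02.val + O02.val) + (O01.val + O01.val) := by
  have h10 : O10 = Finset.map latticeEmbedding
      {(1, 0), (-1, 0), (-1, 3), (1, -3), (2, -3), (-2, 3)} := by
    simp [O10, Finset.map_insert, latticeEmbedding_apply]
  have h01 : O01 = Finset.map latticeEmbedding
      {(0, 1), (0, -1), (1, -1), (-1, 1), (-1, 2), (1, -2)} := by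
    simp [O01, Finset.map_insert, latticeEmbedding_apply]
  have h02 : O02 = Finset.map latticeEmbedding
      {(0, 2), (0, -2), (2, -2), (-2, 2), (-2, 4), (2, -4)} := by
    simp [O02, Finset.map_insert, latticeEmbedding_apply]
  have h11 : O11 = Finset.map latticeEmbedding
      {(1, 1), (-1, -1), (-1, 4), (1, -4), (3, -4), (-3, 4),
       (-3, 5), (3, -5), (2, -5), (-2, 5), (-2, 1), (2, -1)} := by
    simp [O11, Finset.map_insert, latticeEmbedding_apply]
  rw [h10, h01, h02, h11]
  simp only [Finset.map_val, Multiset.bind_map, Multiset.map_map, Function.comp_def,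
    ← latticeEmbedding_add]
  simp_rw [← Multiset.map_add]
  refine Eq.trans ?_ (congrArg (Multiset.map latticeEmbedding) (a₁ :=
    Multiset.bind (Finset.val {(1, 0), (-1, 0), (-1, 3), (1, -3), (2, -3), (-2, 3)}) fun p =>
      Multiset.map (fun q => p + q)
        (Finset.val {(0, 1), (0, -1), (1, -1), (-1, 1), (-1, 2), (1, -2)})) (by decide))
  simp only [Multiset.map_bind, Multiset.map_map, Function.comp_def]

theorem product_of_G2_orbits :
    (↑O10 : Set (ℝ × ℝ)) = MulAction.orbit GG2 ((1, 0) : ℝ × ℝ) ∧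
    (↑O01 : Set (ℝ × ℝ)) = MulAction.orbit GG2 ((0, 1) : ℝ × ℝ) ∧
    (↑O02 : Set (ℝ × ℝ)) = MulAction.orbit GG2 ((0, 2) : ℝ × ℝ) ∧
    (↑O11 : Set (ℝ × ℝ)) = MulAction.orbit GG2 ((1, 1) : ℝ × ℝ) ∧
    (O10.val.bind fun p => O01.val.map fun q => p + q) =
      O11.val + (O02.val + O02.val) + (O01.val + O01.val) := by
  refine ⟨?_, ?_, ?_, coe_O11, bind_O10_O01⟩
  · rw [orbit_fst]
    norm_num [O10]
  · rw [orbit_snd]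
    norm_num [O01]
  · rw [orbit_snd]
    norm_num [O02]
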